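/- arXiv:2501.00887 — 4 statements merged into one kernel-verified Lean document; each statement's English description precedes it below -/
import Mathlib

section
/- Let σ : ℝ² → ℂ be continuously differentiable and suppose there is a constant C₀ such that |σ(y)| ≤ C₀ (1 + |y|)^{−3} and |∇σ(y)| ≤ C₀ (1 + |y|)^{−4} for all y ∈ ℝ². Define the single layer potential S[σ](x) = ∫_{ℝ²} σ(y) / (4π ‖x − (y₁, y₂, 0)‖) dy for x ∈ ℝ³. Then there exists a constant C such that for all x = (x₁, x₂, x₃) ∈ ℝ³ with x₃ < 0 and ‖x‖ ≥ 1, the radial directional derivative satisfies |(x/‖x‖) · ∇S[σ](x)| ≤ C / ‖x‖², where ∇S[σ] denotes the ℝ³-gradient of S[σ] (which exists at every point off the plane z = 0). -/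
open MeasureTheory

/-- The embedding of `ℝ²` into the plane `z = 0` in `ℝ³`. -/
noncomputable def planeEmbed (y : EuclideanSpace ℝ (Fin 2)) :
    EuclideanSpace ℝ (Fin 3) :=
  (EuclideanSpace.equiv (Fin 3) ℝ).symm ![y 0, y 1, 0]

/-- The single layer potential `S[σ](x) = ∫_{ℝ²} σ(y)/(4π‖x − (y₁,y₂,0)‖) dy`. -/
noncomputable def singleLayer (σ : EuclideanSpace ℝ (Fin 2) → ℂ)
    (x : EuclideanSpace ℝ (Fin 3)) : ℂ :=
  ∫ y : EuclideanSpace ℝ (Fin 2),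
    σ y / ((4 * Real.pi * ‖x - planeEmbed y‖ : ℝ) : ℂ)

theorem planeEmbed_smul (c : ℝ) (y : EuclideanSpace ℝ (Fin 2)) :
    planeEmbed (c • y) = c • planeEmbed y := by
  ext i
  fin_cases i <;> simp [planeEmbed]

theorem continuous_planeEmbed : Continuous planeEmbed := by
  unfold planeEmbed
  refine (EuclideanSpace.equiv (Fin 3) ℝ).symm.continuous.comp ?_
  refine continuous_pi fun i => ?_
  fin_cases i <;> simp <;> fun_prop

theorem norm_planeEmbed (y : EuclideanSpace ℝ (Fin 2)) : ‖planeEmbed y‖ = ‖y‖ := by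
  simp [EuclideanSpace.norm_eq, Fin.sum_univ_three, planeEmbed]

theorem abs_apply_two_le_norm_sub_planeEmbed (x : EuclideanSpace ℝ (Fin 3))
    (y : EuclideanSpace ℝ (Fin 2)) : |x 2| ≤ ‖x - planeEmbed y‖ := by
  simpa [planeEmbed] using PiLp.norm_apply_le (x - planeEmbed y) 2

theorem norm_sub_le_norm_sub_planeEmbed (x : EuclideanSpace ℝ (Fin 3))
    (y : EuclideanSpace ℝ (Fin 2)) : ‖y - !₂[x 0, x 1]‖ ≤ ‖x - planeEmbed y‖ := by
  rw [← norm_neg, neg_sub, EuclideanSpace.norm_eq, EuclideanSpace.norm_eq]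
  apply Real.sqrt_le_sqrt
  simp [Fin.sum_univ_three, planeEmbed]
  positivity

theorem integrable_inv_one_add_norm_pow_three :
    Integrable fun y : EuclideanSpace ℝ (Fin 2) => ((1 + ‖y‖) ^ 3)⁻¹ := by
  have h := integrable_one_add_norm (E := EuclideanSpace ℝ (Fin 2)) (μ := volume) (r := 3)
    (by simp; norm_num)
  refine h.congr (Filter.Eventually.of_forall fun y => ?_)
  have : (0 : ℝ) ≤ 1 + ‖y‖ := by positivity
  simp only [Real.rpow_neg this]
  norm_cast

theorem singleLayer_eq_integral_smul (σ : EuclideanSpace ℝ (Fin 2) → ℂ)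
    (x : EuclideanSpace ℝ (Fin 3)) :
    singleLayer σ x = ∫ y, (4 * Real.pi * ‖x - planeEmbed y‖)⁻¹ • σ y := by
  simp only [singleLayer, Complex.real_smul, Complex.ofReal_inv, div_eq_inv_mul]

theorem le_four_mul_pi_mul {a b : ℝ} (hb : 0 < b) (hab : b ≤ a) : b ≤ 4 * Real.pi * a := by
  nlinarith [Real.pi_gt_three]

theorem kernel_le {x : EuclideanSpace ℝ (Fin 3)} (hx : x 2 ≠ 0) (y : EuclideanSpace ℝ (Fin 2)) :
    (4 * Real.pi * ‖x - planeEmbed y‖)⁻¹ ≤ |x 2|⁻¹ :=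
  inv_anti₀ (abs_pos.2 hx) (le_four_mul_pi_mul (abs_pos.2 hx)
    (abs_apply_two_le_norm_sub_planeEmbed x y))

/-- The kernel of the single layer potential is continuous in `y` when `x` is off the plane. -/
theorem continuous_kernel {x : EuclideanSpace ℝ (Fin 3)} (hx : x 2 ≠ 0) :
    Continuous fun y => (4 * Real.pi * ‖x - planeEmbed y‖)⁻¹ := by
  have := continuous_planeEmbed
  refine Continuous.inv₀ (by fun_prop) fun y => ?_
  have h1 := abs_apply_two_le_norm_sub_planeEmbed x y
  have h2 := abs_pos.2 hx
  have : 0 < ‖x - planeEmbed y‖ := by linarith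
  positivity

theorem integrable_kernel_smul {σ : EuclideanSpace ℝ (Fin 2) → ℂ} (hσ : Continuous σ) {M : ℝ}
    (hM : ∀ y, ‖σ y‖ ≤ M / (1 + ‖y‖) ^ 3) {x : EuclideanSpace ℝ (Fin 3)} (hx : x 2 ≠ 0) :
    Integrable fun y => (4 * Real.pi * ‖x - planeEmbed y‖)⁻¹ • σ y := by
  refine (integrable_inv_one_add_norm_pow_three.const_mul (|x 2|⁻¹ * M)).mono'
    ((continuous_kernel hx).smul hσ).aestronglyMeasurable (.of_forall fun y => ?_)
  rw [norm_smul, Real.norm_of_nonneg (by positivity), mul_assoc |x 2|⁻¹, ← div_eq_mul_inv]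
  exact mul_le_mul (kernel_le hx y) (hM y) (norm_nonneg _) (by positivity)

theorem differentiableAt_singleLayer {σ : EuclideanSpace ℝ (Fin 2) → ℂ} (hσ : Continuous σ)
    {M : ℝ} (hM : ∀ y, ‖σ y‖ ≤ M / (1 + ‖y‖) ^ 3) {x : EuclideanSpace ℝ (Fin 3)}
    (hx : x 2 ≠ 0) : DifferentiableAt ℝ (singleLayer σ) x := by
  have hd := abs_pos.2 hx
  let G : EuclideanSpace ℝ (Fin 3) → EuclideanSpace ℝ (Fin 3) →L[ℝ] ℝ :=
    fderiv ℝ fun v => (4 * Real.pi * ‖v‖)⁻¹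
  have hs : {z : EuclideanSpace ℝ (Fin 3) | |x 2| / 2 < |z 2|} ∈ nhds x :=
    (isOpen_lt (by fun_prop) (by fun_prop)).mem_nhds (half_lt_self hd)
  have key := hasFDerivAt_integral_of_dominated_loc_of_lip' (μ := volume) (𝕜 := ℝ)
    (F := fun z y => (4 * Real.pi * ‖z - planeEmbed y‖)⁻¹ • σ y)
    (F' := fun y => (G (x - planeEmbed y)).smulRight (σ y))
    (bound := fun y => (|x 2|⁻¹ * (|x 2| / 2)⁻¹) * M * ((1 + ‖y‖) ^ 3)⁻¹) hs
    (fun z hz => ?_) (integrable_kernel_smul hσ hM hx) ?_ (.of_forall fun y z hz => ?_)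
    (integrable_inv_one_add_norm_pow_three.const_mul _) (.of_forall fun y => ?_)
  · rw [show singleLayer σ = _ from funext (singleLayer_eq_integral_smul σ)]
    exact key.2.differentiableAt
  · have hz' : z 2 ≠ 0 := by
      rw [← abs_pos]
      have : |x 2| / 2 < |z 2| := hz
      linarith
    exact ((continuous_kernel hz').smul hσ).aestronglyMeasurable
  · have h1 : AEStronglyMeasurable (fun y => G (x - planeEmbed y)) volume :=
      ((measurable_fderiv ℝ _).comp
        (continuous_const.sub continuous_planeEmbed).measurable).aestronglyMeasurable
    exact (ContinuousLinearMap.smulRightL ℝ (EuclideanSpace ℝ (Fin 3)) ℂ).aestronglyMeasurable_comp₂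
      h1 hσ.aestronglyMeasurable
  · have hz1 : |x 2| / 2 < |z 2| := hz
    have h1 := abs_apply_two_le_norm_sub_planeEmbed x y
    have h2 := abs_apply_two_le_norm_sub_planeEmbed z y
    set a := ‖x - planeEmbed y‖
    set b := ‖z - planeEmbed y‖
    have ha : 0 < a := by linarith
    have hb : 0 < b := by linarith
    have hab : |a - b| ≤ ‖z - x‖ := by
      have := abs_norm_sub_norm_le (x - planeEmbed y) (z - planeEmbed y)
      rwa [sub_sub_sub_cancel_right, norm_sub_rev x z] at this
    have hk : (4 * Real.pi * b)⁻¹ - (4 * Real.pi * a)⁻¹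
        = (4 * Real.pi * a)⁻¹ * b⁻¹ * (a - b) := by
      field_simp
    rw [← sub_smul, norm_smul, hk, norm_mul, Real.norm_of_nonneg (by positivity), Real.norm_eq_abs]
    calc (4 * Real.pi * a)⁻¹ * b⁻¹ * |a - b| * ‖σ y‖
        ≤ |x 2|⁻¹ * (|x 2| / 2)⁻¹ * ‖z - x‖ * (M / (1 + ‖y‖) ^ 3) := by
          gcongr
          · exact le_four_mul_pi_mul hd h1
          · linarith
          · exact hM y
      _ = _ := by ring
  · have h1 := abs_apply_two_le_norm_sub_planeEmbed x y
    have hne : x - planeEmbed y ≠ 0 := norm_pos_iff.1 (by linarith)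
    have hG : HasFDerivAt (fun v : EuclideanSpace ℝ (Fin 3) => (4 * Real.pi * ‖v‖)⁻¹)
        (G (x - planeEmbed y)) (x - planeEmbed y) := by
      refine DifferentiableAt.hasFDerivAt ?_
      refine DifferentiableAt.inv ?_ ?_
      · exact ((contDiffAt_norm ℝ hne).differentiableAt one_ne_zero).const_mul _
      · have := norm_pos_iff.2 hne
        positivity
    exact (hG.comp x ((hasFDerivAt_id x).sub_const (planeEmbed y))).smul_const (σ y)

theorem exists_norm_singleLayer_le : ∃ K : ℝ, ∀ (τ : EuclideanSpace ℝ (Fin 2) → ℂ) (M : ℝ),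
    (∀ y, ‖τ y‖ ≤ M / (1 + ‖y‖) ^ 3) → ∀ x : EuclideanSpace ℝ (Fin 3), 1 ≤ ‖x‖ →
      ‖singleLayer τ x‖ ≤ M * K / ‖x‖ := by
  let f (r : ℝ) : ℝ → ℝ := (Set.Iio r).indicator fun t => t⁻¹
  have hfin : Module.finrank ℝ (EuclideanSpace ℝ (Fin 2)) = 2 := by simp
  have hmul (r : ℝ) : Set.EqOn (fun t : ℝ => t ^ (2 - 1) • f r t)
      ((Set.Iio r).indicator fun _ => 1) (Set.Ioi 0) := by
    intro t (ht : 0 < t)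
    by_cases htr : t < r <;> simp [f, htr, ht.ne']
  have hf_int (r : ℝ) : Integrable fun y : EuclideanSpace ℝ (Fin 2) => f r ‖y‖ := by
    rw [integrable_fun_norm_addHaar, hfin, integrableOn_congr_fun (hmul r) measurableSet_Ioi,
      IntegrableOn, integrable_indicator_iff measurableSet_Iio, IntegrableOn,
      Measure.restrict_restrict measurableSet_Iio]
    simp [Set.Iio_inter_Ioi]
  have hf_val (r : ℝ) (hr : 0 ≤ r) : ∫ y : EuclideanSpace ℝ (Fin 2), f r ‖y‖
      = 2 * volume.real (Metric.ball (0 : EuclideanSpace ℝ (Fin 2)) 1) * r := by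
    rw [integral_fun_norm_addHaar, hfin, setIntegral_congr_fun measurableSet_Ioi (hmul r),
      integral_indicator measurableSet_Iio, Measure.restrict_restrict measurableSet_Iio]
    simp [Set.Iio_inter_Ioi, hr, mul_assoc]
  set V := 2 * volume.real (Metric.ball (0 : EuclideanSpace ℝ (Fin 2)) 1)
  set A := ∫ y : EuclideanSpace ℝ (Fin 2), ((1 + ‖y‖) ^ 3)⁻¹
  have hV : 0 ≤ V := by positivity
  refine ⟨2 * A + 8 * V, fun τ M hM x hx => ?_⟩
  have hM0 : 0 ≤ M := by simpa using (norm_nonneg _).trans (hM 0)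
  set r := ‖x‖ with hr
  have hr0 : 0 < r := by linarith
  let c : EuclideanSpace ℝ (Fin 2) := !₂[x 0, x 1]
  have hg1 := integrable_inv_one_add_norm_pow_three.const_mul (2 * M / r)
  have hg2 := ((hf_int r).comp_sub_right c).const_mul (8 * M / r ^ 3)
  rw [singleLayer_eq_integral_smul]
  refine (norm_integral_le_of_norm_le (hg1.add hg2) ?_).trans ?_
  · filter_upwards [compl_mem_ae_iff.2 (measure_singleton c)] with y hy
    have hyc : 0 < ‖y - c‖ := norm_pos_iff.2 (sub_ne_zero.2 hy)
    have hle : ‖y - c‖ ≤ ‖x - planeEmbed y‖ := norm_sub_le_norm_sub_planeEmbed x y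
    have htri : r ≤ ‖x - planeEmbed y‖ + ‖y‖ := by
      simpa [norm_planeEmbed] using norm_add_le (x - planeEmbed y) (planeEmbed y)
    have hf0 : 0 ≤ f r ‖y - c‖ := by
      by_cases h : ‖y - c‖ < r <;> simp [f, h]
    rw [norm_smul, Real.norm_of_nonneg (by positivity)]
    simp only [Pi.add_apply]
    rcases le_or_gt (r / 2) ‖x - planeEmbed y‖ with h | h
    · calc _ ≤ (r / 2)⁻¹ * (M / (1 + ‖y‖) ^ 3) := by
            gcongr
            · exact le_four_mul_pi_mul (by positivity) h
            · exact hM y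
        _ = 2 * M / r * ((1 + ‖y‖) ^ 3)⁻¹ := by field_simp
        _ ≤ _ := le_add_of_nonneg_right (by positivity)
    · have hfe : f r ‖y - c‖ = ‖y - c‖⁻¹ :=
        Set.indicator_of_mem (Set.mem_Iio.2 (by linarith)) _
      rw [hfe]
      calc _ ≤ ‖y - c‖⁻¹ * (M / (r / 2) ^ 3) := by
            gcongr
            · exact le_four_mul_pi_mul hyc hle
            · refine (hM y).trans ?_
              gcongr
              linarith
        _ = 8 * M / r ^ 3 * ‖y - c‖⁻¹ := by field_simp; norm_num
        _ ≤ _ := le_add_of_nonneg_left (by positivity)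
  · simp only [Pi.add_apply]
    rw [integral_add hg1 hg2, integral_const_mul, integral_const_mul,
      integral_sub_right_eq_self (fun y => f r ‖y‖) c, hf_val r hr0.le]
    have : 8 * M / r ^ 3 * (V * r) ≤ 8 * M * V / r := by
      rw [show 8 * M / r ^ 3 * (V * r) = 8 * M * V / r ^ 2 by field_simp]
      gcongr
      nlinarith
    calc _ ≤ 2 * M / r * A + 8 * M * V / r := by gcongr
      _ = _ := by ring

theorem singleLayer_smul (σ : EuclideanSpace ℝ (Fin 2) → ℂ) (x : EuclideanSpace ℝ (Fin 3))
    {t : ℝ} (ht : 0 < t) :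
    singleLayer σ (t • x)
      = t • ∫ u, (4 * Real.pi * ‖x - planeEmbed u‖)⁻¹ • σ (t • u) := by
  have h := Measure.integral_comp_smul (volume : Measure (EuclideanSpace ℝ (Fin 2)))
    (fun y => (4 * Real.pi * ‖t • x - planeEmbed y‖)⁻¹ • σ y) t
  rw [← singleLayer_eq_integral_smul] at h
  have h2 : (fun u => (4 * Real.pi * ‖t • x - planeEmbed (t • u)‖)⁻¹ • σ (t • u))
      = fun u => t⁻¹ • ((4 * Real.pi * ‖x - planeEmbed u‖)⁻¹ • σ (t • u)) := by
    funext u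
    rw [planeEmbed_smul, ← smul_sub, norm_smul, Real.norm_of_nonneg ht.le, smul_smul]
    congr 1
    rw [← mul_inv]
    ring_nf
  rw [h2, integral_smul, abs_of_nonneg (by positivity)] at h
  rw [show singleLayer σ (t • x) = t ^ 2 • (t ^ 2)⁻¹ • singleLayer σ (t • x) by
    rw [smul_smul, mul_inv_cancel₀ (by positivity), one_smul]]
  simp only [finrank_euclideanSpace, Fintype.card_fin] at h
  rw [← h, smul_smul]
  congr 1
  field_simp

theorem norm_fderiv_apply_self_le {σ : EuclideanSpace ℝ (Fin 2) → ℂ} {C₀ : ℝ}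
    (h : ∀ y, ‖fderiv ℝ σ y‖ ≤ C₀ / (1 + ‖y‖) ^ 4) (y : EuclideanSpace ℝ (Fin 2)) :
    ‖fderiv ℝ σ y y‖ ≤ C₀ / (1 + ‖y‖) ^ 3 := by
  have hC : 0 ≤ C₀ := by simpa using (norm_nonneg _).trans (h 0)
  calc ‖fderiv ℝ σ y y‖ ≤ C₀ / (1 + ‖y‖) ^ 4 * (1 + ‖y‖) := by
        refine ((fderiv ℝ σ y).le_opNorm y).trans ?_
        gcongr
        · exact h y
        · linarith
    _ = _ := by field_simp

/-- The radial derivative of the single layer potential is again a single layer potential. -/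
theorem fderiv_singleLayer_apply_self {σ : EuclideanSpace ℝ (Fin 2) → ℂ} (hσ : ContDiff ℝ 1 σ)
    {C₀ : ℝ} (hσ0 : ∀ y, ‖σ y‖ ≤ C₀ / (1 + ‖y‖) ^ 3)
    (hσ1 : ∀ y, ‖fderiv ℝ σ y‖ ≤ C₀ / (1 + ‖y‖) ^ 4) {x : EuclideanSpace ℝ (Fin 3)}
    (hx : x 2 ≠ 0) :
    fderiv ℝ (singleLayer σ) x x
      = singleLayer σ x + singleLayer (fun y => fderiv ℝ σ y y) x := by
  have hC : 0 ≤ C₀ := by simpa using (norm_nonneg _).trans (hσ0 0)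
  have hdiff := differentiableAt_singleLayer hσ.continuous hσ0 hx
  have hL : HasDerivAt (fun t : ℝ => singleLayer σ (t • x)) (fderiv ℝ (singleLayer σ) x x) 1 := by
    have h1 : HasDerivAt (fun t : ℝ => t • x) x 1 := by
      simpa using (hasDerivAt_id (1 : ℝ)).smul_const x
    have h2 : HasFDerivAt (singleLayer σ) (fderiv ℝ (singleLayer σ) x) ((1 : ℝ) • x) := by
      simpa using hdiff.hasFDerivAt
    exact h2.comp_hasDerivAt 1 h1
  have hcont : Continuous (fderiv ℝ σ) := hσ.continuous_fderiv one_ne_zero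
  have key := hasDerivAt_integral_of_dominated_loc_of_deriv_le (μ := volume) (𝕜 := ℝ) (x₀ := 1)
    (F := fun t u => (4 * Real.pi * ‖x - planeEmbed u‖)⁻¹ • σ (t • u))
    (F' := fun t u => (4 * Real.pi * ‖x - planeEmbed u‖)⁻¹ • fderiv ℝ σ (t • u) u)
    (bound := fun u => |x 2|⁻¹ * (16 * C₀) * ((1 + ‖u‖) ^ 3)⁻¹)
    (Ioi_mem_nhds (show (1 / 2 : ℝ) < 1 by norm_num))
    (.of_forall fun t => ((continuous_kernel hx).smul
      (hσ.continuous.comp (continuous_const_smul t))).aestronglyMeasurable)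
    (by simpa using integrable_kernel_smul hσ.continuous hσ0 hx)
    ((continuous_kernel hx).smul ((hcont.comp (continuous_const_smul (1 : ℝ))).clm_apply
      continuous_id)).aestronglyMeasurable
    (.of_forall fun u t ht => ?_) (integrable_inv_one_add_norm_pow_three.const_mul _)
    (.of_forall fun u t _ => ?_)
  · have hR := ((hasDerivAt_id (1 : ℝ)).smul key.2).congr_of_eventuallyEq
      (f₁ := fun t : ℝ => singleLayer σ (t • x))
      (by filter_upwards [Ioi_mem_nhds one_pos] with t ht using singleLayer_smul σ x ht)
    rw [hL.unique hR, singleLayer_eq_integral_smul, singleLayer_eq_integral_smul]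
    simp [add_comm]
  · have ht' : 1 / 2 < t := ht
    have hnorm : ‖t • u‖ = t * ‖u‖ := by rw [norm_smul, Real.norm_of_nonneg (by linarith)]
    have hb : ‖fderiv ℝ σ (t • u) u‖ ≤ 16 * C₀ * ((1 + ‖u‖) ^ 3)⁻¹ := by
      calc _ ≤ ‖fderiv ℝ σ (t • u)‖ * ‖u‖ := (fderiv ℝ σ (t • u)).le_opNorm u
        _ ≤ C₀ / ((1 + ‖u‖) / 2) ^ 4 * (1 + ‖u‖) := by
          gcongr
          · refine (hσ1 _).trans ?_
            rw [hnorm]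
            gcongr
            nlinarith [norm_nonneg u]
          · linarith
        _ = _ := by field_simp; norm_num
    rw [norm_smul, Real.norm_of_nonneg (by positivity), mul_assoc |x 2|⁻¹]
    exact mul_le_mul (kernel_le hx u) hb (norm_nonneg _) (by positivity)
  · have h1 : HasDerivAt (fun s : ℝ => s • u) u t := by
      simpa using (hasDerivAt_id t).smul_const u
    exact ((hσ.differentiable one_ne_zero _).hasFDerivAt.comp_hasDerivAt t h1).const_smul
      (4 * Real.pi * ‖x - planeEmbed u‖)⁻¹

/-- Decay of the radial derivative of the single layer potential: if `σ` is
`C¹` with `|σ(y)| ≤ C₀(1+|y|)⁻³` and `|∇σ(y)| ≤ C₀(1+|y|)⁻⁴`, then `S[σ]` is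
differentiable off the plane `z = 0` and for `x₃ < 0`, `‖x‖ ≥ 1`, the radial
directional derivative satisfies `|(x/‖x‖)·∇S[σ](x)| ≤ C/‖x‖²`. -/
theorem stmt_14 (σ : EuclideanSpace ℝ (Fin 2) → ℂ) (hσ : ContDiff ℝ 1 σ)
    (C₀ : ℝ)
    (hσ0 : ∀ y, ‖σ y‖ ≤ C₀ / (1 + ‖y‖) ^ 3)
    (hσ1 : ∀ y, ‖fderiv ℝ σ y‖ ≤ C₀ / (1 + ‖y‖) ^ 4) :
    ∃ C : ℝ, ∀ x : EuclideanSpace ℝ (Fin 3), x 2 < 0 → 1 ≤ ‖x‖ →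
      DifferentiableAt ℝ (singleLayer σ) x ∧
      ‖fderiv ℝ (singleLayer σ) x (‖x‖⁻¹ • x)‖ ≤ C / ‖x‖ ^ 2 := by
  obtain ⟨K, hK⟩ := exists_norm_singleLayer_le
  refine ⟨2 * (C₀ * K), fun x hx hx1 =>
    ⟨differentiableAt_singleLayer hσ.continuous hσ0 hx.ne, ?_⟩⟩
  have hpos : 0 < ‖x‖ := by linarith
  rw [map_smul, fderiv_singleLayer_apply_self hσ hσ0 hσ1 hx.ne, norm_smul, norm_inv, norm_norm]
  calc _ ≤ ‖x‖⁻¹ * (C₀ * K / ‖x‖ + C₀ * K / ‖x‖) := by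
        gcongr
        exact norm_add_le_of_le (hK _ _ hσ0 x hx1)
          (hK _ _ (norm_fderiv_apply_self_le hσ1) x hx1)
    _ = _ := by field_simp; ring
end

section
/- For every point r ∈ ℝ² and every R > 0, the integral of the Newtonian surface kernel over the annulus A_{R,4R} = { r' ∈ ℝ² : R ≤ |r'| ≤ 4R } satisfies ∫_{A_{R,4R}} 1/(4π |r − r'|) dA(r') ≤ 1/2 + (15/4) R². -/
open MeasureTheory

open Set Metric

/-- On `(0, ∞)`, the radial density of the kernel truncated to the unit ball is constant on
`(0, 1)`. -/
lemma eqOn_radial_newtonKernel :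
    EqOn (fun y : ℝ ↦ y ^ (Module.finrank ℝ (EuclideanSpace ℝ (Fin 2)) - 1) •
        (Iio (1 : ℝ)).indicator (fun s ↦ 1 / (4 * Real.pi * s)) y)
      ((Iio (1 : ℝ)).indicator fun _ ↦ 1 / (4 * Real.pi)) (Ioi 0) := by
  intro y (hy : 0 < y)
  by_cases h : y < 1
  · simp only [finrank_euclideanSpace_fin, smul_eq_mul, mem_Iio, h, indicator_of_mem]
    field_simp
    norm_num
  · simp [h]

/-- The kernel `1/(4π|x|)` truncated to the unit disc is integrable. -/
lemma integrable_newtonKernel_unitBall :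
    Integrable fun x : EuclideanSpace ℝ (Fin 2) ↦
      (Iio (1 : ℝ)).indicator (fun s ↦ 1 / (4 * Real.pi * s)) ‖x‖ := by
  rw [integrable_fun_norm_addHaar volume
      (f := (Iio (1 : ℝ)).indicator fun s ↦ 1 / (4 * Real.pi * s)),
    integrableOn_congr_fun eqOn_radial_newtonKernel measurableSet_Ioi,
    IntegrableOn, integrable_indicator_iff measurableSet_Iio, IntegrableOn,
    Measure.restrict_restrict measurableSet_Iio, inter_comm, Ioi_inter_Iio]
  exact integrable_const _

/-- The kernel `1/(4π|x|)` has integral `1/2` over the unit disc. -/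
lemma integral_newtonKernel_unitBall :
    ∫ x : EuclideanSpace ℝ (Fin 2),
      (Iio (1 : ℝ)).indicator (fun s ↦ 1 / (4 * Real.pi * s)) ‖x‖ = 1 / 2 := by
  rw [integral_fun_norm_addHaar volume ((Iio (1 : ℝ)).indicator fun s ↦ 1 / (4 * Real.pi * s)),
    setIntegral_congr_fun measurableSet_Ioi eqOn_radial_newtonKernel,
    setIntegral_indicator measurableSet_Iio, Ioi_inter_Iio, setIntegral_const]
  simp only [measureReal_def, EuclideanSpace.volume_ball_fin_two]
  simp [Real.pi_pos.le]
  field_simp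
  norm_num

/-- The annulus with radii `a ≤ b` has area `π(b² - a²)`. -/
lemma volume_real_annulus {a b : ℝ} (ha : 0 ≤ a) (hab : a ≤ b) :
    volume.real {x : EuclideanSpace ℝ (Fin 2) | a ≤ ‖x‖ ∧ ‖x‖ ≤ b} =
      Real.pi * (b ^ 2 - a ^ 2) := by
  have h : {x : EuclideanSpace ℝ (Fin 2) | a ≤ ‖x‖ ∧ ‖x‖ ≤ b} =
      closedBall 0 b \ ball 0 a := by
    ext x
    simp [and_comm]
  rw [h, measureReal_sdiff (ball_subset_closedBall.trans (closedBall_subset_closedBall hab))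
    measurableSet_ball measure_closedBall_lt_top.ne]
  simp only [measureReal_def, EuclideanSpace.volume_ball_fin_two,
    EuclideanSpace.volume_closedBall_fin_two]
  simp [Real.pi_pos.le, ha, ha.trans hab]
  ring

/-- For every `r ∈ ℝ²` and `R > 0`, the integral of the Newtonian surface
kernel `1/(4π|r − r'|)` over the annulus `{R ≤ |r'| ≤ 4R}` is at most
`1/2 + (15/4)R²`. -/
theorem stmt_15 (r : EuclideanSpace ℝ (Fin 2)) (R : ℝ) (hR : 0 < R) :
    (∫ r' in {r' : EuclideanSpace ℝ (Fin 2) | R ≤ ‖r'‖ ∧ ‖r'‖ ≤ 4 * R},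
        1 / (4 * Real.pi * ‖r - r'‖)) ≤ 1 / 2 + 15 / 4 * R ^ 2 := by
  set A := {r' : EuclideanSpace ℝ (Fin 2) | R ≤ ‖r'‖ ∧ ‖r'‖ ≤ 4 * R} with hA
  have hpi := Real.pi_pos
  have hfin : volume A ≠ ⊤ :=
    ((measure_mono fun x hx ↦ mem_closedBall_zero_iff.2 hx.2).trans_lt
      (measure_closedBall_lt_top (x := 0) (r := 4 * R))).ne
  let k : ℝ → ℝ := (Iio (1 : ℝ)).indicator fun s ↦ 1 / (4 * Real.pi * s)
  have hk : Integrable fun r' ↦ k ‖r - r'‖ := integrable_newtonKernel_unitBall.comp_sub_left r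
  have hk0 (x : EuclideanSpace ℝ (Fin 2)) : 0 ≤ k ‖r - x‖ :=
    indicator_apply_nonneg fun _ ↦ by positivity
  have hc : IntegrableOn (fun _ ↦ 1 / (4 * Real.pi)) A := integrableOn_const hfin
  calc
    _ ≤ ∫ r' in A, (k ‖r - r'‖ + 1 / (4 * Real.pi)) := by
      refine integral_mono_of_nonneg (.of_forall fun x ↦ by positivity) (hk.integrableOn.add hc)
        (.of_forall fun x ↦ ?_)
      by_cases h : ‖r - x‖ < 1
      · have : 0 ≤ 1 / (4 * Real.pi) := by positivity
        simpa [k, h] using this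
      · have hx : 1 ≤ ‖r - x‖ := not_lt.1 h
        simp only [k, mem_Iio, h, not_false_eq_true, indicator_of_notMem, zero_add]
        exact one_div_le_one_div_of_le (by positivity) (le_mul_of_one_le_right (by positivity) hx)
    _ = (∫ r' in A, k ‖r - r'‖) + ∫ r' in A, 1 / (4 * Real.pi) :=
      integral_add hk.integrableOn hc
    _ ≤ (∫ r', k ‖r - r'‖) + ∫ r' in A, 1 / (4 * Real.pi) :=
      add_le_add_left (setIntegral_le_integral hk (.of_forall hk0)) _
    _ = 1 / 2 + 15 / 4 * R ^ 2 := by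
      rw [integral_sub_left_eq_self (fun x ↦ k ‖x‖) volume r, integral_newtonKernel_unitBall,
        setIntegral_const, hA, volume_real_annulus hR.le (by linarith), smul_eq_mul]
      field_simp
      ring
end

section
/- Let X be a complex Banach space and let A : X → X be a compact continuous linear operator such that I + A is injective. Let H > 0 and let (A_h)_{0 < h ≤ H} be a family of continuous linear operators on X such that: (i) the set { A_h x : 0 < h ≤ H, ‖x‖ ≤ 1 } is relatively compact in X (collective compactness), and (ii) for every x ∈ X, A_h x → A x as h → 0⁺. Then there exist h₀ ∈ (0, H] and a constant M such that for all 0 < h < h₀ the operator I + A_h is bijective and ‖(I + A_h)^{−1} y‖ ≤ M ‖y‖ for all y ∈ X. -/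
open Filter

/-- A compact perturbation of the identity which is injective is bijective. -/
theorem IsCompactOperator.bijective_id_add_of_injective {𝕜 X : Type*}
    [NontriviallyNormedField 𝕜] [NormedAddCommGroup X] [NormedSpace 𝕜 X] [CompleteSpace X]
    {T : X →L[𝕜] X} (hT : IsCompactOperator T)
    (hinj : ∀ x, x + T x = 0 → x = 0) : Function.Bijective fun x => x + T x := by
  rcases hT.hasEigenvalue_or_mem_resolventSet (μ := -1) (by simp) with h | h
  · obtain ⟨v, hv⟩ := h.exists_hasEigenvector
    have hv' : T v = -v := by simpa using hv.apply_eq_smul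
    exact absurd (hinj v (by simp [hv'])) hv.2
  · rw [spectrum.mem_resolventSet_iff, ← IsUnit.neg_iff,
      ContinuousLinearMap.isUnit_iff_bijective] at h
    convert! h using 1
    ext x
    simp [add_comm]

/-- Operators mapping the unit ball into a ball of radius `C` are bounded by `C`. -/
theorem norm_apply_le_of_forall_norm_le_one {𝕜 X Y : Type*} [RCLike 𝕜]
    [NormedAddCommGroup X] [NormedSpace 𝕜 X] [NormedAddCommGroup Y] [NormedSpace 𝕜 Y]
    (T : X →L[𝕜] Y) {C : ℝ} (h : ∀ x, ‖x‖ ≤ 1 → ‖T x‖ ≤ C) (x : X) : ‖T x‖ ≤ C * ‖x‖ := by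
  have hC : 0 ≤ C := (norm_nonneg _).trans (h 0 (by simp))
  exact T.le_of_opNorm_le (T.opNorm_le_of_unit_norm hC fun z hz => h z hz.le) x

/-- Stability of a collectively compact sequence of perturbations of the identity: approximate
null vectors of norm one produce a null vector of the pointwise limit. -/
theorem exists_norm_eq_one_add_apply_eq_zero {𝕜 X : Type*} [RCLike 𝕜]
    [NormedAddCommGroup X] [NormedSpace 𝕜 X] {A : X →L[𝕜] X} {B : ℕ → X →L[𝕜] X} {K : Set X}
    (hK : IsCompact K) (hBK : ∀ n x, ‖x‖ ≤ 1 → B n x ∈ K)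
    (hB : ∀ x, Tendsto (fun n => B n x) atTop (nhds (A x)))
    {u : ℕ → X} (hu : ∀ n, ‖u n‖ = 1)
    (hlim : Tendsto (fun n => u n + B n (u n)) atTop (nhds 0)) :
    ∃ x, ‖x‖ = 1 ∧ x + A x = 0 := by
  obtain ⟨C, hC⟩ := hK.isBounded.exists_norm_le
  obtain ⟨y, -, φ, hφ, hy⟩ := hK.tendsto_subseq fun n => hBK n (u n) (hu n).le
  have hux : Tendsto (fun n => u (φ n)) atTop (nhds (-y)) := by
    simpa using (hlim.comp hφ.tendsto_atTop).sub hy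
  have hdiff : Tendsto (fun n => B (φ n) (u (φ n) - -y)) atTop (nhds 0) := by
    refine squeeze_zero_norm (fun n => norm_apply_le_of_forall_norm_le_one (B (φ n))
      (fun x hx => hC _ (hBK _ x hx)) _) ?_
    simpa using (tendsto_iff_norm_sub_tendsto_zero.1 hux).const_mul C
  have hyA : y = A (-y) := by
    refine tendsto_nhds_unique hy ?_
    simpa [Function.comp_def] using hdiff.add ((hB (-y)).comp hφ.tendsto_atTop)
  refine ⟨-y, tendsto_nhds_unique hux.norm (by simp [hu]), ?_⟩
  rw [← hyA, neg_add_cancel]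

/-- Collectively compact operator approximation (Anselone/Kress): if `A` is a
compact operator on a complex Banach space `X` with `I + A` injective, and
`(A_h)_{0<h≤H}` is a collectively compact family converging pointwise to `A`
as `h → 0⁺`, then for all sufficiently small `h` the operator `I + A_h` is
bijective with uniformly bounded inverse. -/
theorem stmt_17 {X : Type*} [NormedAddCommGroup X] [NormedSpace ℂ X]
    [CompleteSpace X] (A : X →L[ℂ] X) (hA : IsCompactOperator A)
    (hinj : Function.Injective fun x => x + A x)
    (H : ℝ) (hH : 0 < H) (Af : ℝ → X →L[ℂ] X)
    (hcc : IsCompact (closure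
      {y : X | ∃ h x, 0 < h ∧ h ≤ H ∧ ‖x‖ ≤ 1 ∧ y = Af h x}))
    (hpw : ∀ x : X,
      Tendsto (fun h => Af h x) (nhdsWithin 0 (Set.Ioi 0)) (nhds (A x))) :
    ∃ h₀ : ℝ, 0 < h₀ ∧ h₀ ≤ H ∧ ∃ M : ℝ, ∀ h : ℝ, 0 < h → h < h₀ →
      Function.Bijective (fun x => x + Af h x) ∧
      ∀ x : X, ‖x‖ ≤ M * ‖x + Af h x‖ := by
  set K := closure {y : X | ∃ h x, 0 < h ∧ h ≤ H ∧ ‖x‖ ≤ 1 ∧ y = Af h x}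
  have hmem : ∀ h, 0 < h → h ≤ H → ∀ x, ‖x‖ ≤ 1 → Af h x ∈ K := fun h h0 hh x hx =>
    subset_closure ⟨h, x, h0, hh, hx, rfl⟩
  have hbound : ∃ n : ℕ, ∀ h, 0 < h → h < min H (1 / ((n : ℝ) + 1)) →
      ∀ x, ‖x‖ ≤ ((n : ℝ) + 1) * ‖x + Af h x‖ := by
    by_contra! hcon
    choose h h0 hlt v hv using hcon
    have hv0 : ∀ n, 0 < ‖v n‖ := fun n => lt_of_le_of_lt (by positivity) (hv n)
    have hh : Tendsto h atTop (nhdsWithin 0 (Set.Ioi 0)) :=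
      tendsto_nhdsWithin_iff.2 ⟨squeeze_zero (fun n => (h0 n).le)
        (fun n => ((hlt n).trans_le (min_le_right _ _)).le)
        tendsto_one_div_add_atTop_nhds_zero_nat, Eventually.of_forall h0⟩
    obtain ⟨x, hx1, hx⟩ := exists_norm_eq_one_add_apply_eq_zero (A := A)
      (B := fun n => Af (h n)) (u := fun n => ((‖v n‖⁻¹ : ℝ) : ℂ) • v n) hcc
      (fun n => hmem _ (h0 n) ((hlt n).trans_le (min_le_left _ _)).le)
      (fun x => (hpw x).comp hh)
      (fun n => by
        rw [norm_smul, Complex.norm_real, norm_inv, norm_norm, inv_mul_cancel₀ (hv0 n).ne'])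
      (squeeze_zero_norm (fun n => by
        rw [map_smul, ← smul_add, norm_smul, Complex.norm_real, norm_inv, norm_norm,
          inv_mul_le_iff₀ (hv0 n), mul_one_div, le_div_iff₀ (by positivity), mul_comm]
        exact (hv n).le) tendsto_one_div_add_atTop_nhds_zero_nat)
    have hx0 : x = 0 := hinj (by simpa using hx)
    simp [hx0] at hx1
  obtain ⟨n, hn⟩ := hbound
  refine ⟨min H (1 / ((n : ℝ) + 1)), lt_min hH (by positivity), min_le_left _ _,
    (n : ℝ) + 1, fun h h0 hlt => ⟨?_, hn h h0 hlt⟩⟩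
  have hcompact : IsCompactOperator (Af h) := by
    refine (isCompactOperator_iff_image_closedBall_subset_compact
      (Af h : X →ₗ[ℂ] X) one_pos).2 ⟨K, hcc, ?_⟩
    rintro _ ⟨x, hx, rfl⟩
    exact hmem h h0 (hlt.trans_le (min_le_left _ _)).le x (by simpa using hx)
  refine hcompact.bijective_id_add_of_injective fun x hx => ?_
  simpa [hx] using hn h h0 hlt x
end

section
/- Let g : ℝ² → ℂ be a smooth function with compact support. Then for every k ∈ ℕ there exists a constant C (depending on g and k) such that for all h ∈ (0, 1], the trapezoidal-rule error satisfies | h² Σ_{i ∈ ℤ²} g(h i) − ∫_{ℝ²} g(x) dx | ≤ C h^k. -/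
open MeasureTheory

open scoped FourierTransform SchwartzMap ContDiff

/-- All derivatives of a smooth compactly supported function on the line are integrable. -/
theorem integrable_iteratedDeriv_of_hasCompactSupport {f : ℝ → ℂ} (hf : ContDiff ℝ ∞ f)
    (hs : HasCompactSupport f) (n : ℕ) : Integrable (iteratedDeriv n f) := by
  refine (hf.continuous_iteratedDeriv n (mod_cast le_top)).integrable_of_hasCompactSupport ?_
  refine (hs.iteratedFDeriv (𝕜 := ℝ) n).mono fun x hx => ?_
  rw [Function.mem_support, ← norm_ne_zero_iff] at hx ⊢
  rwa [norm_iteratedFDeriv_eq_norm_iteratedDeriv]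

/-- Decay of the Fourier transform of a smooth compactly supported function. -/
theorem norm_fourier_le_of_hasCompactSupport {f : ℝ → ℂ} (hf : ContDiff ℝ ∞ f)
    (hs : HasCompactSupport f) (k : ℕ) {x : ℝ} (hx : x ≠ 0) :
    ‖𝓕 f x‖ ≤ 1 / |x| ^ k * ∫ t, ‖iteratedDeriv k f t‖ := by
  have key : 𝓕 (iteratedDeriv k f) x = (2 * Real.pi * Complex.I * x) ^ k • 𝓕 f x :=
    congrFun (Real.fourier_iteratedDeriv (N := ⊤) hf
      (fun n _ => integrable_iteratedDeriv_of_hasCompactSupport hf hs n) (mod_cast le_top)) x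
  have hle : ‖𝓕 (iteratedDeriv k f) x‖ ≤ ∫ t, ‖iteratedDeriv k f t‖ := by
    rw [Real.fourier_eq]
    refine (norm_integral_le_integral_norm _).trans_eq ?_
    simp
  rw [key, norm_smul, norm_pow] at hle
  have hx' : 0 < |x| := abs_pos.2 hx
  have hpi : |x| ≤ ‖(2 * Real.pi * Complex.I * x : ℂ)‖ := by
    simp only [norm_mul, Complex.norm_ofNat, Complex.norm_real, Complex.norm_I, Real.norm_eq_abs,
      abs_of_pos Real.pi_pos]
    nlinarith [Real.pi_gt_three]
  rw [one_div, inv_mul_eq_div, le_div_iff₀ (by positivity), mul_comm]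
  exact (mul_le_mul_of_nonneg_right (pow_le_pow_left₀ hx'.le hpi k) (norm_nonneg _)).trans hle

/-- The error of the trapezoidal rule with unit step is controlled by the `L¹` norm of a
derivative of order at least two. -/
theorem norm_tsum_int_sub_integral_le {f : ℝ → ℂ} (hf : ContDiff ℝ ∞ f)
    (hs : HasCompactSupport f) {k : ℕ} (hk : 1 < k) :
    ‖∑' n : ℤ, f n - ∫ x, f x‖ ≤
      (∑' n : ℤ, 1 / |(n : ℝ)| ^ k) * ∫ t, ‖iteratedDeriv k f t‖ := by
  have hS : Summable fun n : ℤ => 1 / |(n : ℝ)| ^ k := by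
    simpa [abs_pow] using (Real.summable_one_div_int_pow.2 hk).abs
  have hbound : ∀ n : ℤ, ‖if n = 0 then 0 else 𝓕 f (n : ℝ)‖ ≤
      1 / |(n : ℝ)| ^ k * ∫ t, ‖iteratedDeriv k f t‖ := by
    intro n
    split_ifs with hn
    · rw [norm_zero]
      exact mul_nonneg (by positivity) (integral_nonneg fun _ => norm_nonneg _)
    · exact norm_fourier_le_of_hasCompactSupport hf hs k (mod_cast hn)
  have hsum : Summable fun n : ℤ => 𝓕 f (n : ℝ) := by
    refine (Summable.of_norm_bounded (hS.mul_right _) hbound).congr_cofinite ?_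
    filter_upwards [Set.Finite.compl_mem_cofinite (Set.finite_singleton (0 : ℤ))] with n hn
    exact if_neg hn
  have hpoisson : ∑' n : ℤ, f n = ∑' n : ℤ, 𝓕 f (n : ℝ) := by
    have := (hs.toSchwartzMap hf).tsum_eq_tsum_fourier 0
    rw [SchwartzMap.fourier_coe, show ⇑(hs.toSchwartzMap hf) = f from rfl] at this
    simpa using this
  have hzero : 𝓕 f ((0 : ℤ) : ℝ) = ∫ x, f x := by
    simp [Real.fourier_eq]
  rw [hpoisson, hsum.tsum_eq_add_tsum_ite 0, hzero, add_sub_cancel_left]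
  exact tsum_of_norm_bounded (hS.hasSum.mul_right _) hbound

/-- The error of the trapezoidal rule with step `h`, for functions supported in `[-R, R]` with
a bounded derivative of order at least two. -/
theorem norm_mul_tsum_int_sub_integral_le {f : ℝ → ℂ} (hf : ContDiff ℝ ∞ f) {R M : ℝ}
    (hR : 0 ≤ R) (hs : ∀ x, R < |x| → f x = 0) {k : ℕ} (hk : 1 < k)
    (hM : ∀ x, ‖iteratedDeriv k f x‖ ≤ M) {h : ℝ} (hh : 0 < h) :
    ‖(h : ℂ) * ∑' n : ℤ, f (h * n) - ∫ x, f x‖ ≤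
      (∑' n : ℤ, 1 / |(n : ℝ)| ^ k) * (M * (2 * R)) * h ^ k := by
  have hts : tsupport f ⊆ Set.Icc (-R) R :=
    closure_minimal (fun x hx => abs_le.1 (not_lt.1 fun hlt => hx (hs x hlt))) isClosed_Icc
  have hc : HasCompactSupport f := isCompact_Icc.of_isClosed_subset (isClosed_tsupport f) hts
  have hcomp : HasCompactSupport fun x => f (h * x) :=
    hc.comp_homeomorph (Homeomorph.mulLeft₀ h hh.ne')
  have hsmooth : ContDiff ℝ ∞ fun x => f (h * x) := by fun_prop
  have hL1 : ∫ t, ‖iteratedDeriv k f t‖ ≤ M * (2 * R) := by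
    have hzero : ∀ t, t ∉ Set.Icc (-R) R → ‖iteratedDeriv k f t‖ = 0 := by
      intro t ht
      rw [← norm_iteratedFDeriv_eq_norm_iteratedDeriv (𝕜 := ℝ), norm_eq_zero]
      by_contra hne
      exact ht (hts (support_iteratedFDeriv_subset (𝕜 := ℝ) k hne))
    rw [← setIntegral_eq_integral_of_forall_compl_eq_zero hzero]
    have := norm_setIntegral_le_of_norm_le_const (μ := volume) (s := Set.Icc (-R) R)
      (f := fun t => ‖iteratedDeriv k f t‖) (C := M) (by simp) (fun x _ => by simpa using hM x)
    rw [Real.volume_real_Icc_of_le (by linarith)] at this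
    exact (Real.le_norm_self _).trans (this.trans_eq (by ring))
  have hscale : ∫ x, f (h * x) = (h : ℂ)⁻¹ * ∫ x, f x := by
    rw [Measure.integral_comp_mul_left f h, abs_of_pos (inv_pos.2 hh), Complex.real_smul,
      Complex.ofReal_inv]
  have hder : ∫ t, ‖iteratedDeriv k (fun x => f (h * x)) t‖ =
      h ^ k * (h⁻¹ * ∫ t, ‖iteratedDeriv k f t‖) := by
    rw [iteratedDeriv_comp_const_smul (hf.of_le (mod_cast le_top)) h]
    simp_rw [norm_smul]
    rw [integral_const_mul, Measure.integral_comp_mul_left (fun t => ‖iteratedDeriv k f t‖) h,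
      abs_of_pos (inv_pos.2 hh), smul_eq_mul, norm_pow, Real.norm_of_nonneg hh.le]
  have hmain := norm_tsum_int_sub_integral_le hsmooth hcomp hk
  rw [hscale, hder] at hmain
  have hhC : (h : ℂ) ≠ 0 := mod_cast hh.ne'
  have hS : 0 ≤ ∑' n : ℤ, 1 / |(n : ℝ)| ^ k := tsum_nonneg fun _ => by positivity
  calc ‖(h : ℂ) * ∑' n : ℤ, f (h * n) - ∫ x, f x‖
      = h * ‖∑' n : ℤ, f (h * n) - (h : ℂ)⁻¹ * ∫ x, f x‖ := by
        have hnorm : ∀ z : ℂ, ‖(h : ℂ) * z‖ = h * ‖z‖ := fun z => by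
          rw [norm_mul, Complex.norm_real, Real.norm_of_nonneg hh.le]
        rw [← hnorm, mul_sub, mul_inv_cancel_left₀ hhC]
    _ ≤ h * ((∑' n : ℤ, 1 / |(n : ℝ)| ^ k) * (h ^ k * (h⁻¹ * ∫ t, ‖iteratedDeriv k f t‖))) := by
        gcongr
    _ = (∑' n : ℤ, 1 / |(n : ℝ)| ^ k) * (∫ t, ‖iteratedDeriv k f t‖) * h ^ k := by
        field_simp
    _ ≤ _ := by gcongr

/-- Derivatives of the restriction of a function to an affine line. -/
theorem norm_iteratedDeriv_comp_add_le {E : Type*} [NormedAddCommGroup E] [NormedSpace ℝ E]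
    {g : E → ℂ} (hg : ContDiff ℝ ∞ g) {k : ℕ} {M : ℝ} (hM : ∀ z, ‖iteratedFDeriv ℝ k g z‖ ≤ M)
    (a : E) (L : ℝ →L[ℝ] E) (hL : ‖L‖ ≤ 1) (t : ℝ) :
    ‖iteratedDeriv k (fun s => g (a + L s)) t‖ ≤ M := by
  rw [← norm_iteratedFDeriv_eq_norm_iteratedDeriv (𝕜 := ℝ)]
  change ‖iteratedFDeriv ℝ k ((fun z => g (a + z)) ∘ L) t‖ ≤ M
  have hsmooth : ContDiff ℝ ∞ fun z => g (a + z) := by fun_prop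
  rw [L.iteratedFDeriv_comp_right hsmooth t (mod_cast le_top), iteratedFDeriv_comp_add_left]
  refine (ContinuousMultilinearMap.norm_compContinuousLinearMap_le _ _).trans ?_
  rw [Finset.prod_const]
  exact (mul_le_of_le_one_right (norm_nonneg _) (pow_le_one₀ (norm_nonneg _) hL)).trans (hM _)

/-- Super-algebraic convergence of the trapezoidal rule for a smooth compactly
supported function `g : ℝ² → ℂ`: for every `k` there is a constant `C` such
that for all `0 < h ≤ 1`,
`|h² ∑_{i ∈ ℤ²} g(hi) − ∫_{ℝ²} g| ≤ C h^k`. -/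
theorem stmt_18 (g : ℝ × ℝ → ℂ) (hg : ContDiff ℝ (⊤ : ℕ∞) g)
    (hsupp : HasCompactSupport g) (k : ℕ) :
    ∃ C : ℝ, ∀ h : ℝ, 0 < h → h ≤ 1 →
      ‖((h : ℂ) ^ 2 * ∑' i : ℤ × ℤ, g (h * (i.1 : ℝ), h * (i.2 : ℝ))) -
          ∫ x : ℝ × ℝ, g x‖ ≤ C * h ^ k := by
  obtain ⟨R, hR, hball⟩ := hsupp.isBounded.subset_closedBall_lt 0 0
  have hzero : ∀ x y, R < |x| ∨ R < |y| → g (x, y) = 0 := by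
    intro x y hxy
    by_contra hne
    have hmem := hball (subset_tsupport g (show (x, y) ∈ Function.support g from hne))
    rw [mem_closedBall_zero_iff, Prod.norm_def, max_le_iff] at hmem
    simp only [Real.norm_eq_abs] at hmem
    rcases hxy with hx | hy
    · exact hx.not_ge hmem.1
    · exact hy.not_ge hmem.2
  have hord : ∀ m : ℕ, (m : WithTop ℕ∞) ≤ ∞ := fun m => mod_cast le_top
  obtain ⟨M, hM⟩ := (hg.continuous_iteratedFDeriv (hord (k + 2))).bounded_above_of_compact_support (hsupp.iteratedFDeriv (k + 2))
  have hM0 : 0 ≤ M := (norm_nonneg _).trans (hM 0)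
  have hcont := hg.continuous
  have hgint : Integrable g := hcont.integrable_of_hasCompactSupport hsupp
  set D := (∑' n : ℤ, 1 / |(n : ℝ)| ^ (k + 2)) * (M * (2 * R))
  have hD0 : 0 ≤ D := mul_nonneg (tsum_nonneg fun _ => by positivity) (by positivity)
  refine ⟨(2 * R + 3) * D + D * (2 * R), fun h hh hh1 => ?_⟩
  set N : ℤ := ⌈R / h⌉
  set F : Finset ℤ := Finset.Icc (-N) N with hF
  have hout : ∀ n : ℤ, n ∉ F → R < |h * n| := by
    intro n hn
    have hNn : N < |n| := by
      rw [hF, Finset.mem_Icc, ← abs_le, not_le] at hn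
      exact hn
    have hlt : R / h < |(n : ℝ)| := (Int.le_ceil _).trans_lt (mod_cast hNn)
    rw [div_lt_iff₀ hh] at hlt
    rwa [abs_mul, abs_of_pos hh, mul_comm]
  have hcard : h * (F.card : ℝ) ≤ 2 * R + 3 := by
    have hN0 : 0 ≤ N := Int.ceil_nonneg (by positivity)
    have hFc : (F.card : ℝ) = 2 * N + 1 := by
      have : (F.card : ℤ) = 2 * N + 1 := by rw [hF, Int.card_Icc]; lia
      exact mod_cast this
    have hlt : (N : ℝ) < R / h + 1 := Int.ceil_lt_add_one _
    have hRh : h * (R / h) = R := mul_div_cancel₀ R hh.ne'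
    rw [hFc]
    nlinarith
  have hrow : ∀ x, ‖(h : ℂ) * ∑ j ∈ F, g (x, h * j) - ∫ y, g (x, y)‖ ≤ D * h ^ (k + 2) := by
    intro x
    rw [← tsum_eq_sum (L := .unconditional ℤ) (s := F)
      (f := fun j : ℤ => g (x, h * j)) fun j hj => hzero _ _ (.inr (hout j hj))]
    refine norm_mul_tsum_int_sub_integral_le (f := fun y => g (x, y)) (by fun_prop) hR.le
      (fun y hy => hzero _ _ (.inr hy)) (by lia) (fun t => ?_) hh
    simpa using norm_iteratedDeriv_comp_add_le hg hM (x, 0) (.inr ℝ ℝ ℝ)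
      (ContinuousLinearMap.norm_inr_le_one ℝ ℝ ℝ) t
  have hcol : ∀ y, ‖(h : ℂ) * ∑ i ∈ F, g (h * i, y) - ∫ x, g (x, y)‖ ≤ D * h ^ (k + 2) := by
    intro y
    rw [← tsum_eq_sum (L := .unconditional ℤ) (s := F)
      (f := fun i : ℤ => g (h * i, y)) fun i hi => hzero _ _ (.inl (hout i hi))]
    refine norm_mul_tsum_int_sub_integral_le (f := fun x => g (x, y)) (by fun_prop) hR.le
      (fun x hx => hzero _ _ (.inl hx)) (by lia) (fun t => ?_) hh
    simpa using norm_iteratedDeriv_comp_add_le hg hM (0, y) (.inl ℝ ℝ ℝ)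
      (ContinuousLinearMap.norm_inl_le_one ℝ ℝ ℝ) t
  have hslice : ∀ x, Integrable fun y => g (x, y) := by
    intro x
    refine Continuous.integrable_of_hasCompactSupport (by fun_prop) ?_
    exact HasCompactSupport.intro (isCompact_Icc (a := -R) (b := R)) fun y hy =>
      hzero _ _ (.inr (not_le.1 fun hle => hy (abs_le.1 hle)))
  have hsum : ∑' i : ℤ × ℤ, g (h * (i.1 : ℝ), h * (i.2 : ℝ)) =
      ∑ i ∈ F, ∑ j ∈ F, g (h * i, h * j) := by
    rw [tsum_eq_sum (s := F ×ˢ F), Finset.sum_product]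
    intro i hi
    rw [Finset.mem_product, not_and_or] at hi
    exact hzero _ _ (hi.imp (hout _) (hout _))
  have hfub : ∫ z : ℝ × ℝ, g z = ∫ y, ∫ x, g (x, y) := by
    rw [Measure.volume_eq_prod] at hgint ⊢
    exact integral_prod_symm g hgint
  have hinner : Integrable fun y => ∫ x, g (x, y) := by
    rw [Measure.volume_eq_prod] at hgint
    exact hgint.integral_prod_right
  have hsplit : (h : ℂ) ^ 2 * (∑ i ∈ F, ∑ j ∈ F, g (h * i, h * j)) - ∫ y, ∫ x, g (x, y) =
      h * (∑ i ∈ F, ((h : ℂ) * ∑ j ∈ F, g (h * i, h * j) - ∫ y, g (h * i, y))) +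
        ∫ y, ((h : ℂ) * ∑ i ∈ F, g (h * i, y) - ∫ x, g (x, y)) := by
    rw [integral_sub ((integrable_finsetSum F fun i _ => hslice _).const_mul _) hinner,
      integral_const_mul, integral_finsetSum F fun i _ => hslice _, Finset.sum_sub_distrib,
      ← Finset.mul_sum]
    ring
  have hfirst : ‖(h : ℂ) * ∑ i ∈ F,
      ((h : ℂ) * ∑ j ∈ F, g (h * i, h * j) - ∫ y, g (h * i, y))‖ ≤
        (2 * R + 3) * (D * h ^ (k + 2)) := by
    rw [norm_mul, Complex.norm_real, Real.norm_of_nonneg hh.le]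
    have hle := norm_sum_le_of_le F fun (i : ℤ) _ => hrow (h * i)
    rw [Finset.sum_const, nsmul_eq_mul] at hle
    refine (mul_le_mul_of_nonneg_left hle hh.le).trans ?_
    rw [← mul_assoc]
    gcongr
  have hsecond : ‖∫ y, ((h : ℂ) * ∑ i ∈ F, g (h * i, y) - ∫ x, g (x, y))‖ ≤
      D * h ^ (k + 2) * (2 * R) := by
    rw [← setIntegral_eq_integral_of_forall_compl_eq_zero (s := Set.Icc (-R) R)]
    · refine (norm_setIntegral_le_of_norm_le_const (by simp) fun y _ => hcol y).trans_eq ?_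
      rw [Real.volume_real_Icc_of_le (by linarith)]
      ring
    · intro y hy
      have hy' : ∀ x, g (x, y) = 0 := fun x =>
        hzero _ _ (.inr (not_le.1 fun hle => hy (abs_le.1 hle)))
      simp [hy']
  have hpow : h ^ (k + 2) ≤ h ^ k := pow_le_pow_of_le_one hh.le hh1 (by lia)
  rw [hsum, hfub, hsplit]
  calc _ ≤ (2 * R + 3) * (D * h ^ (k + 2)) + D * h ^ (k + 2) * (2 * R) :=
        norm_add_le_of_le hfirst hsecond
    _ = ((2 * R + 3) * D + D * (2 * R)) * h ^ (k + 2) := by ring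
    _ ≤ _ := by gcongr
end
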